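/- Let M be a matroid on a finite ground set U that is not the free matroid (i.e., 𝒞(M) ≠ ∅). Then M is connected if and only if for every nonempty proper subset X ⊂ U, overline{R(M)}(X) ∩ X^C ≠ ∅, where X^C = U \ X is the complement of X in U. -/

import Mathlib

open Set

/-- A circuit of a matroid `M`: a minimal dependent subset of the ground set. -/
def IsCircuit {α : Type*} (M : Matroid α) (C : Set α) : Prop :=
  M.Dep C ∧ ∀ D, D ⊂ C → M.Indep D

/-- The relation `R(M)` induced from the matroid `M`:
`x R(M) y` iff there is a circuit of `M` containing both `x` and `y`. -/
def matroidRel {α : Type*} (M : Matroid α) (x y : α) : Prop :=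
  ∃ C, IsCircuit M C ∧ x ∈ C ∧ y ∈ C

/-- The successor neighborhood `R(M)N(x) = {y | x R(M) y}`. -/
def nbhd {α : Type*} (M : Matroid α) (x : α) : Set α :=
  {y | matroidRel M x y}

/-- The upper approximation of `X` with respect to `R(M)`. -/
def upperApprox {α : Type*} (M : Matroid α) (X : Set α) : Set α :=
  {x | (nbhd M x ∩ X).Nonempty}

/-- A matroid (with ground set the whole type) is connected iff every pair of
distinct elements lies in a common circuit. -/
def MatroidConnected {α : Type*} (M : Matroid α) : Prop :=
  ∀ x y : α, x ≠ y → ∃ C, IsCircuit M C ∧ x ∈ C ∧ y ∈ C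

theorem isCircuit_iff_matroid_isCircuit {α : Type*} {M : Matroid α} {C : Set α} :
    IsCircuit M C ↔ M.IsCircuit C :=
  Matroid.isCircuit_iff_forall_ssubset.symm

/-- Two elements that lie on intersecting circuits of a finitary matroid lie on a common one. -/
theorem Matroid.IsCircuit.exists_isCircuit_mem_mem_of_inter_nonempty {α : Type*} {M : Matroid α}
    [M.Finitary] {C₁ C₂ : Set α} {x z : α} (hC₁ : M.IsCircuit C₁) (hC₂ : M.IsCircuit C₂)
    (hx : x ∈ C₁) (hz : z ∈ C₂) (hne : (C₁ ∩ C₂).Nonempty) :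
    ∃ C, M.IsCircuit C ∧ x ∈ C ∧ z ∈ C := by
  induction hn : (C₁ ∪ C₂).ncard using Nat.strong_induction_on generalizing C₁ C₂ with
  | _ n ih =>
    by_cases hx₂ : x ∈ C₂
    · exact ⟨C₂, hC₂, hx₂, hz⟩
    by_cases hz₁ : z ∈ C₁
    · exact ⟨C₁, hC₁, hx, hz₁⟩
    have hfin : (C₁ ∪ C₂).Finite := hC₁.finite.union hC₂.finite
    have descend {D₁ D₂ : Set α} (hD₁ : M.IsCircuit D₁) (hD₂ : M.IsCircuit D₂) (hxD : x ∈ D₁)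
        (hzD : z ∈ D₂) (hD : (D₁ ∩ D₂).Nonempty) (hss : D₁ ∪ D₂ ⊂ C₁ ∪ C₂) :
        ∃ C, M.IsCircuit C ∧ x ∈ C ∧ z ∈ C :=
      ih _ (hn ▸ Set.ncard_lt_ncard hss hfin) hD₁ hD₂ hxD hzD hD rfl
    obtain ⟨e, he₁, he₂⟩ := hne
    obtain ⟨C₃, hC₃ss, hC₃, hx₃⟩ := hC₁.strong_elimination hC₂ he₁ he₂ hx hx₂
    obtain ⟨C₄, hC₄ss, hC₄, hz₄⟩ := hC₂.strong_elimination hC₁ he₂ he₁ hz hz₁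
    have he₃ : e ∉ C₃ := fun h ↦ (hC₃ss h).2 rfl
    have he₄ : e ∉ C₄ := fun h ↦ (hC₄ss h).2 rfl
    have hC₃u : C₃ ⊆ C₁ ∪ C₂ := fun a ha ↦ (hC₃ss ha).1
    have hC₄u : C₄ ⊆ C₁ ∪ C₂ := fun a ha ↦ (hC₄ss ha).1.symm
    by_cases hu : C₁ ∪ C₂ ⊆ C₃ ∪ C₂
    · obtain ⟨b, hb₄, hb₂⟩ : ∃ b ∈ C₄, b ∉ C₂ := Set.not_subset.1 fun h ↦
        he₄ (hC₄.eq_of_subset_isCircuit hC₂ h ▸ he₂)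
      have hb₃ : b ∈ C₃ := (hu (hC₄u hb₄)).resolve_right hb₂
      exact descend hC₃ hC₄ hx₃ hz₄ ⟨b, hb₃, hb₄⟩
        ⟨Set.union_subset hC₃u hC₄u, fun h ↦ (h (.inl he₁)).elim he₃ he₄⟩
    · obtain ⟨a, ha₃, ha₁⟩ : ∃ a ∈ C₃, a ∉ C₁ := Set.not_subset.1 fun h ↦
        he₃ (hC₃.eq_of_subset_isCircuit hC₁ h ▸ he₁)
      exact descend hC₃ hC₂ hx₃ hz ⟨a, ha₃, (hC₃u ha₃).resolve_left ha₁⟩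
        ⟨Set.union_subset hC₃u Set.subset_union_right, hu⟩

theorem matroidRel_symm {α : Type*} {M : Matroid α} {x y : α} (h : matroidRel M x y) :
    matroidRel M y x :=
  let ⟨C, hC, hx, hy⟩ := h
  ⟨C, hC, hy, hx⟩

theorem matroidRel_trans {α : Type*} {M : Matroid α} [M.Finitary] {x y z : α}
    (hxy : matroidRel M x y) (hyz : matroidRel M y z) : matroidRel M x z := by
  obtain ⟨C₁, hC₁, hx, hy₁⟩ := hxy
  obtain ⟨C₂, hC₂, hy₂, hz⟩ := hyz
  rw [isCircuit_iff_matroid_isCircuit] at hC₁ hC₂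
  obtain ⟨C, hC, hxC, hzC⟩ :=
    hC₁.exists_isCircuit_mem_mem_of_inter_nonempty hC₂ hx hz ⟨y, hy₁, hy₂⟩
  exact ⟨C, isCircuit_iff_matroid_isCircuit.2 hC, hxC, hzC⟩

theorem matroidConnected_iff_upperApprox_inter_compl_nonempty {α : Type*} [Fintype α]
    (M : Matroid α) (hE : M.E = Set.univ) (hM : {C | IsCircuit M C}.Nonempty) :
    MatroidConnected M ↔
      ∀ X : Set α, X.Nonempty → X ⊂ Set.univ →
        (upperApprox M X ∩ Xᶜ).Nonempty := by
  constructor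
  · intro h X hX hXu
    obtain ⟨a, ha⟩ := hX
    obtain ⟨b, -, hb⟩ := Set.exists_of_ssubset hXu
    exact ⟨b, ⟨a, h b a fun hba ↦ hb (hba ▸ ha), ha⟩, hb⟩
  · intro h x y hxy
    obtain ⟨w, ⟨v, hwv, rfl⟩, -⟩ := h {x} (Set.singleton_nonempty x)
      (Set.ssubset_univ_iff.2 fun hu ↦ hxy (hu.ge (Set.mem_univ y)).symm)
    have hvv : matroidRel M v v := matroidRel_trans (matroidRel_symm hwv) hwv
    by_contra hvy
    obtain ⟨u, ⟨t, hut, hvt⟩, hvu⟩ := h (nbhd M v) ⟨v, hvv⟩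
      (Set.ssubset_univ_iff.2 fun hu ↦ hvy (hu.ge (Set.mem_univ y)))
    exact hvu (matroidRel_trans hvt (matroidRel_symm hut))
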